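/- arXiv:2309.00574 — 2 statements merged into one kernel-verified Lean document; each statement's English description precedes it below -/
import Mathlib

section
/- Let λ be a real number with max{1, p} < λ ≤ p + m/n. Then every global weak solution u of u_t − Σ_{|α|=m} ∂^α a_α(x,t,u) ≥ |u|^λ in ℝ^{n+1}_+ with u(·,0) = u_0 ≥ 0 is trivial, i.e. u = 0 almost everywhere in ℝ^{n+1}_+. -/
open MeasureTheory Real Set Filter

noncomputable section

/-- The spatial domain `ℝⁿ`. -/
abbrev Spc (n : ℕ) := EuclideanSpace ℝ (Fin n)

/-- The open ball `B_r` in `ℝⁿ` of radius `r` centered at `0`. -/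
def ball0 (n : ℕ) (r : ℝ) : Set (Spc n) := Metric.ball 0 r

/-- The cylinder `Q_r^κ = B_r × (0, r^κ)`. -/
def cyl (n : ℕ) (r κ : ℝ) : Set (Spc n × ℝ) := ball0 n r ×ˢ Ioo 0 (r ^ κ)

/-- The half-space `ℝ^{n+1}_+ = ℝⁿ × (0, ∞)`. -/
def halfSp (n : ℕ) : Set (Spc n × ℝ) := {z | 0 < z.2}

/-- The (finite) set of multi-indices `α` with `|α| = m`. -/
def mIdx (n m : ℕ) : Finset (Fin n → ℕ) :=
  (Fintype.piFinset fun _ : Fin n => Finset.range (m + 1)).filter fun α => ∑ i, α i = m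

/-- Spatial partial derivative `∂/∂x_i`. -/
def spDeriv (n : ℕ) (i : Fin n) (φ : Spc n × ℝ → ℝ) : Spc n × ℝ → ℝ :=
  fun z => deriv (fun s : ℝ => φ (z.1 + s • EuclideanSpace.single i (1 : ℝ), z.2)) 0

/-- Time derivative `∂/∂t`. -/
def tDeriv (n : ℕ) (φ : Spc n × ℝ → ℝ) : Spc n × ℝ → ℝ :=
  fun z => deriv (fun s : ℝ => φ (z.1, s)) z.2

/-- Multi-index spatial derivative `∂^α`. -/
def mDeriv (n : ℕ) (α : Fin n → ℕ) (φ : Spc n × ℝ → ℝ) : Spc n × ℝ → ℝ :=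
  (List.finRange n).foldr (fun i ψ => (spDeriv n i)^[α i] ψ) φ

/-- Caratheodory conditions and the growth bound `|a_α(x,t,ζ)| ≤ A |ζ|^p` for the
coefficients of the operator `L`. -/
def GoodCoeffs (n m : ℕ) (A p : ℝ) (a : (Fin n → ℕ) → Spc n × ℝ → ℝ → ℝ) : Prop :=
  ∀ α ∈ mIdx n m,
    (∀ ζ : ℝ, Measurable fun z => a α z ζ) ∧
    (∀ᵐ z ∂(volume.restrict (halfSp n)), Continuous fun ζ => a α z ζ) ∧
    (∀ᵐ z ∂(volume.restrict (halfSp n)), ∀ ζ : ℝ, |a α z ζ| ≤ A * |ζ| ^ p)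

/-- The standing conditions on `f`: `ζ ↦ f ζ` and `ζ ↦ f (ζ^{1/p})` are nondecreasing
and convex on `[0,∞)`, and `f` is positive on `(0,∞)`. -/
def GoodF (p : ℝ) (f : ℝ → ℝ) : Prop :=
  MonotoneOn f (Ici 0) ∧ ConvexOn ℝ (Ici 0) f ∧
  MonotoneOn (fun ζ => f (ζ ^ (1 / p))) (Ici 0) ∧
  ConvexOn ℝ (Ici 0) (fun ζ => f (ζ ^ (1 / p))) ∧
  ∀ ζ : ℝ, 0 < ζ → 0 < f ζ

/-- Condition (1.4): `∫_1^∞ ζ^{1/k - 1} f(ζ)^{-1/k} dζ < ∞`. -/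
def Cond14 (k : ℕ) (f : ℝ → ℝ) : Prop :=
  IntegrableOn (fun ζ : ℝ => ζ ^ ((k : ℝ)⁻¹ - 1) / f ζ ^ ((k : ℝ)⁻¹)) (Ioi 1)

/-- Condition (1.5): `∫_1^∞ ζ^{p/m - 1} f(ζ)^{-1/m} dζ < ∞`. -/
def Cond15 (m : ℕ) (p : ℝ) (f : ℝ → ℝ) : Prop :=
  IntegrableOn (fun ζ : ℝ => ζ ^ (p / (m : ℝ) - 1) / f ζ ^ ((m : ℝ)⁻¹)) (Ioi 1)

/-- `v ∈ L^1_loc(ℝⁿ)`. -/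
def L1locInit (n : ℕ) (v : Spc n → ℝ) : Prop :=
  ∀ r : ℝ, 0 < r → IntegrableOn v (ball0 n r)

/-- `u` is a global weak solution of
`∂_t^k u - Σ_{|α| = m} ∂^α a_α(x,t,u) ≥ f(|u|)` in `ℝ^{n+1}_+`, with initial data
`∂_t^i u(·,0) = u0 i` for `0 ≤ i ≤ k-1`. -/
def IsGlobalWeakSol (n k m : ℕ) (p : ℝ) (a : (Fin n → ℕ) → Spc n × ℝ → ℝ → ℝ)
    (f : ℝ → ℝ) (u0 : ℕ → Spc n → ℝ) (u : Spc n × ℝ → ℝ) : Prop :=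
  (∀ r : ℝ, 0 < r → IntegrableOn u (cyl n r 1)) ∧
  (∀ r : ℝ, 0 < r → IntegrableOn (fun z => |u z| ^ p) (cyl n r 1)) ∧
  (∀ r : ℝ, 0 < r → IntegrableOn (fun z => f |u z|) (cyl n r 1)) ∧
  ∀ φ : Spc n × ℝ → ℝ, ContDiff ℝ (⊤ : ℕ∞) φ → HasCompactSupport φ →
    (∀ z, 0 ≤ φ z) →
    (∫ z in halfSp n, (-1 : ℝ) ^ k * u z * (tDeriv n)^[k] φ z)
      - (∫ z in halfSp n, ∑ α ∈ mIdx n m, (-1 : ℝ) ^ m * a α z (u z) * mDeriv n α φ z)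
    ≥ (∫ x : Spc n, ∑ i ∈ Finset.range k,
          (-1 : ℝ) ^ i * u0 (k - 1 - i) x * (tDeriv n)^[i] φ (x, 0))
      + ∫ z in halfSp n, f |u z| * φ z

/-- `u = 0` almost everywhere in `ℝ^{n+1}_+`. -/
def TrivialSol (n : ℕ) (u : Spc n × ℝ → ℝ) : Prop :=
  ∀ᵐ z ∂(volume.restrict (halfSp n)), u z = 0

/-- Young's inequality in the form used to absorb lower powers of `X`. -/
lemma rpow_mul_le_add_rpow {θ k X y : ℝ} (hθ0 : 0 < θ) (hθ1 : θ < 1) (hk : 0 < k)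
    (hX : 0 ≤ X) (hy : 0 ≤ y) :
    y * X ^ θ ≤ k * X + k ^ (-θ / (1 - θ)) * y ^ (1 / (1 - θ)) := by
  have h1 : 0 < 1 - θ := by linarith
  have hb : 0 ≤ k ^ (-θ / (1 - θ)) * y ^ (1 / (1 - θ)) := by positivity
  have key := Real.geom_mean_le_arith_mean2_weighted hθ0.le h1.le (mul_nonneg hk.le hX) hb
    (by ring)
  have hleft : (k * X) ^ θ * (k ^ (-θ / (1 - θ)) * y ^ (1 / (1 - θ))) ^ (1 - θ)
      = y * X ^ θ := by
    rw [Real.mul_rpow hk.le hX, Real.mul_rpow (by positivity) (by positivity),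
      ← Real.rpow_mul hk.le, ← Real.rpow_mul hy, div_mul_cancel₀ _ h1.ne',
      div_mul_cancel₀ _ h1.ne', Real.rpow_one, Real.rpow_neg hk.le]
    have : k ^ θ ≠ 0 := (Real.rpow_pos_of_pos hk _).ne'
    field_simp
  rw [hleft] at key
  have := mul_nonneg hk.le hX
  nlinarith

/-- If `|h| ≤ y X^θ` and `h` vanishes on `s`, then `∫ h` is controlled by the integral of `X`
off `s`, up to an error depending only on the measure of the support. -/
lemma abs_integral_le_of_le_rpow {Ω : Type*} [MeasurableSpace Ω] {μ : Measure Ω}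
    {X h : Ω → ℝ} {s t : Set Ω} {θ k y : ℝ} (hθ0 : 0 < θ) (hθ1 : θ < 1) (hk : 0 < k)
    (hy : 0 ≤ y) (hs : MeasurableSet s) (ht : MeasurableSet t) (htμ : μ t ≠ ⊤)
    (hX : Integrable X μ) (hX0 : ∀ z, 0 ≤ X z) (hXt : ∀ z ∉ t, X z = 0)
    (hh : ∀ᵐ z ∂μ, |h z| ≤ y * X z ^ θ) (hhs : ∀ z ∈ s, h z = 0) :
    |∫ z, h z ∂μ| ≤
      k * ∫ z in sᶜ, X z ∂μ + k ^ (-θ / (1 - θ)) * y ^ (1 / (1 - θ)) * μ.real t := by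
  set K := k ^ (-θ / (1 - θ)) * y ^ (1 / (1 - θ)) with hK
  have hK0 : 0 ≤ K := by positivity
  have i1 : Integrable (fun z => k * sᶜ.indicator X z) μ :=
    (hX.indicator hs.compl).const_mul k
  have i2 : Integrable (t.indicator fun _ => K) μ :=
    (integrable_indicator_iff ht).2 (integrableOn_const htμ)
  have hbound : ∀ᵐ z ∂μ, ‖h z‖ ≤ k * sᶜ.indicator X z + t.indicator (fun _ => K) z := by
    filter_upwards [hh] with z hz
    have ht0 : 0 ≤ t.indicator (fun _ => K) z := indicator_nonneg (fun _ _ => hK0) z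
    rw [Real.norm_eq_abs]
    by_cases hzs : z ∈ s
    · simpa [hzs, hhs z hzs] using ht0
    · rw [indicator_of_mem (by simpa using hzs)]
      by_cases hzt : z ∈ t
      · rw [indicator_of_mem hzt]
        exact hz.trans (rpow_mul_le_add_rpow hθ0 hθ1 hk (hX0 z) hy)
      · rw [hXt z hzt, Real.zero_rpow hθ0.ne'] at hz
        rw [hXt z hzt]
        linarith
  have := norm_integral_le_of_norm_le (i1.add i2) hbound
  rw [Real.norm_eq_abs] at this
  refine this.trans (le_of_eq ?_)
  simp only [Pi.add_apply]
  rw [integral_add i1 i2, integral_const_mul, integral_indicator hs.compl,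
    integral_indicator_const _ ht, smul_eq_mul, mul_comm K]

/-- `ψ` is `χ^j` times a smooth function, and on `U` it equals `1` if `j = s` and `0` otherwise.
Derivatives of `χ^s` are of this form when `χ = 1` on `U`. -/
def IsLevel {E : Type*} [NormedAddCommGroup E] [NormedSpace ℝ E] (χ : E → ℝ) (U : Set E)
    (s j : ℕ) (ψ : E → ℝ) : Prop :=
  j ≤ s ∧ (∃ g : E → ℝ, ContDiff ℝ (⊤ : ℕ∞) g ∧ ψ = fun z => χ z ^ j * g z) ∧
    ∀ z ∈ U, ψ z = if j = s then 1 else 0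

lemma IsLevel.contDiff {E : Type*} [NormedAddCommGroup E] [NormedSpace ℝ E] {χ : E → ℝ}
    {U : Set E} {s j : ℕ} {ψ : E → ℝ} (h : IsLevel χ U s j ψ)
    (hχ : ContDiff ℝ (⊤ : ℕ∞) χ) : ContDiff ℝ (⊤ : ℕ∞) ψ := by
  obtain ⟨-, ⟨g, hg, rfl⟩, -⟩ := h
  exact (hχ.pow j).mul hg

lemma IsLevel.fderiv_apply {E : Type*} [NormedAddCommGroup E] [NormedSpace ℝ E] {χ : E → ℝ}
    {U : Set E} {s j : ℕ} {ψ : E → ℝ} (h : IsLevel χ U s (j + 1) ψ)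
    (hχ : ContDiff ℝ (⊤ : ℕ∞) χ) (hU : IsOpen U) (v : E) :
    IsLevel χ U s j fun z => fderiv ℝ ψ z v := by
  obtain ⟨hjs, ⟨g, hg, hψ⟩, hψU⟩ := h
  have hd : ∀ f : E → ℝ, ContDiff ℝ (⊤ : ℕ∞) f →
      ContDiff ℝ (⊤ : ℕ∞) fun z => fderiv ℝ f z v := fun f hf =>
    (hf.fderiv_right (m := (⊤ : ℕ∞)) (by simp)).clm_apply contDiff_const
  refine ⟨by omega, ⟨fun z => (j + 1) * fderiv ℝ χ z v * g z + χ z * fderiv ℝ g z v,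
    ((contDiff_const.mul (hd χ hχ)).mul hg).add (hχ.mul (hd g hg)), ?_⟩, fun z hz => ?_⟩
  · funext z
    have h1 : HasFDerivAt χ (fderiv ℝ χ z) z := (hχ.differentiable (by simp) z).hasFDerivAt
    have h2 : HasFDerivAt g (fderiv ℝ g z) z := (hg.differentiable (by simp) z).hasFDerivAt
    have h3 : HasFDerivAt (fun z => χ z ^ (j + 1) * g z) _ z := (h1.pow (j + 1)).mul h2
    rw [hψ, h3.fderiv]
    simp
    ring
  · have : ψ =ᶠ[nhds z] fun _ => if j + 1 = s then (1 : ℝ) else 0 :=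
      (hU.mem_nhds hz) |> fun hm => Filter.mem_of_superset hm hψU
    simp [this.fderiv_eq, show j ≠ s by omega]

lemma spDeriv_eq_fderiv {n : ℕ} (i : Fin n) {ψ : Spc n × ℝ → ℝ} (hψ : Differentiable ℝ ψ) :
    spDeriv n i ψ = fun z => fderiv ℝ ψ z (EuclideanSpace.single i (1 : ℝ), 0) := by
  funext z
  have h1 : HasDerivAt (fun s : ℝ => (z.1 + s • EuclideanSpace.single i (1 : ℝ), z.2))
      (EuclideanSpace.single i (1 : ℝ), (0 : ℝ)) 0 := by
    refine HasDerivAt.prodMk ?_ (hasDerivAt_const _ _)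
    simpa using ((hasDerivAt_id (0 : ℝ)).smul_const
      (EuclideanSpace.single i (1 : ℝ))).const_add z.1
  have h2 : HasFDerivAt ψ (fderiv ℝ ψ z)
      ((fun s : ℝ => (z.1 + s • EuclideanSpace.single i (1 : ℝ), z.2)) 0) := by
    simpa using (hψ z).hasFDerivAt
  exact (h2.comp_hasDerivAt 0 h1).deriv

lemma tDeriv_eq_fderiv {n : ℕ} {ψ : Spc n × ℝ → ℝ} (hψ : Differentiable ℝ ψ) :
    tDeriv n ψ = fun z => fderiv ℝ ψ z (0, 1) := by
  funext z
  have h1 : HasDerivAt (fun s : ℝ => (z.1, s)) ((0 : Spc n), (1 : ℝ)) z.2 :=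
    (hasDerivAt_const _ _).prodMk (hasDerivAt_id _)
  exact ((hψ z).hasFDerivAt.comp_hasDerivAt z.2 h1).deriv

lemma IsLevel.spDeriv_iterate {n : ℕ} {χ : Spc n × ℝ → ℝ} {U : Set (Spc n × ℝ)}
    (hχ : ContDiff ℝ (⊤ : ℕ∞) χ) (hU : IsOpen U) (i : Fin n) {s j k : ℕ}
    {ψ : Spc n × ℝ → ℝ} (h : IsLevel χ U s (j + k) ψ) :
    IsLevel χ U s j ((spDeriv n i)^[k] ψ) := by
  induction k generalizing ψ with
  | zero => exact h
  | succ k ih =>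
    rw [Function.iterate_succ_apply]
    refine ih ?_
    rw [spDeriv_eq_fderiv i ((h.contDiff hχ).differentiable (by simp))]
    exact IsLevel.fderiv_apply (j := j + k) h hχ hU _

lemma IsLevel.multiDeriv {n : ℕ} {χ : Spc n × ℝ → ℝ} {U : Set (Spc n × ℝ)}
    (hχ : ContDiff ℝ (⊤ : ℕ∞) χ) (hU : IsOpen U) (α : Fin n → ℕ) {s j : ℕ}
    {ψ : Spc n × ℝ → ℝ} (h : IsLevel χ U s (j + ∑ i, α i) ψ) :
    IsLevel χ U s j (mDeriv n α ψ) := by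
  have key : ∀ (l : List (Fin n)) (j : ℕ), IsLevel χ U s (j + (l.map α).sum) ψ →
      IsLevel χ U s j (l.foldr (fun i ψ => (spDeriv n i)^[α i] ψ) ψ) := by
    intro l
    induction l with
    | nil => intro j hj; simpa using hj
    | cons b l ih =>
      intro j hj
      rw [List.foldr_cons]
      refine IsLevel.spDeriv_iterate hχ hU b (ih _ ?_)
      simpa [add_assoc] using hj
  refine key _ j ?_
  rwa [← Fin.sum_univ_def]

lemma IsLevel.exists_abs_le {E : Type*} [NormedAddCommGroup E] [NormedSpace ℝ E]
    [FiniteDimensional ℝ E] {χ : E → ℝ} {U : Set E} {s j : ℕ} {ψ : E → ℝ} {r θ : ℝ}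
    (h : IsLevel χ U s j ψ) (hχ0 : ∀ z, 0 ≤ χ z) (hχ1 : ∀ z, χ z ≤ 1)
    (hχr : ∀ z, χ z ≠ 0 → z ∈ Metric.ball (0 : E) r) (hj0 : j ≠ 0) (hj : s * θ ≤ j) :
    ∃ C, 0 ≤ C ∧ ∀ z, |ψ z| ≤ C * (χ z ^ s) ^ θ := by
  obtain ⟨-, ⟨g, hg, rfl⟩, -⟩ := h
  obtain ⟨C, hC⟩ := (isCompact_closedBall (0 : E) r).exists_bound_of_continuousOn
    hg.continuous.continuousOn
  refine ⟨max C 0, le_max_right _ _, fun z => ?_⟩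
  have hpow : 0 ≤ (χ z ^ s) ^ θ := Real.rpow_nonneg (pow_nonneg (hχ0 z) _) _
  rcases eq_or_ne (χ z) 0 with hz | hz
  · have : 0 ≤ max C 0 * (χ z ^ s) ^ θ := mul_nonneg (le_max_right _ _) hpow
    simpa [hz, hj0] using this
  · have hg' : |g z| ≤ max C 0 :=
      (hC z (Metric.ball_subset_closedBall (hχr z hz))).trans (le_max_left _ _)
    have hpos : 0 < χ z := lt_of_le_of_ne (hχ0 z) hz.symm
    have hle : χ z ^ j ≤ (χ z ^ s) ^ θ := by
      rw [← Real.rpow_natCast, ← Real.rpow_natCast, ← Real.rpow_mul (hχ0 z)]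
      exact Real.rpow_le_rpow_of_exponent_ge hpos (hχ1 z) hj
    rw [abs_mul, abs_of_nonneg (pow_nonneg (hχ0 z) j), mul_comm]
    exact mul_le_mul hg' hle (pow_nonneg (hχ0 z) j) (le_max_right _ _)

/-- A cutoff function whose derivatives are dominated by prescribed powers of itself. -/
lemma exists_cutoff (n m : ℕ) (hm : 1 ≤ m) {θ₁ θ₂ : ℝ} (h₁ : θ₁ < 1) (h₂ : θ₂ < 1) :
    ∃ (Φ : Spc n × ℝ → ℝ) (C : ℝ), ContDiff ℝ (⊤ : ℕ∞) Φ ∧ 0 ≤ C ∧ (∀ z, 0 ≤ Φ z) ∧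
      (∀ z, Φ z ≤ 1) ∧ (∀ z ∈ Metric.ball 0 1, Φ z = 1) ∧
      (∀ z ∉ Metric.ball 0 2, Φ z = 0) ∧
      (∀ z, |tDeriv n Φ z| ≤ C * Φ z ^ θ₁) ∧ (∀ z ∈ Metric.ball 0 1, tDeriv n Φ z = 0) ∧
      (∀ α ∈ mIdx n m, ∀ z ∈ Metric.ball 0 1, mDeriv n α Φ z = 0) ∧
      ∀ z, ∑ α ∈ mIdx n m, |mDeriv n α Φ z| ≤ C * Φ z ^ θ₂ := by
  let χ : ContDiffBump (0 : Spc n × ℝ) := ⟨1, 2, one_pos, one_lt_two⟩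
  have hχ : ContDiff ℝ (⊤ : ℕ∞) χ := χ.contDiff
  have hχU : ∀ z ∈ Metric.ball (0 : Spc n × ℝ) 1, χ z = 1 := fun z hz =>
    χ.one_of_mem_closedBall (Metric.ball_subset_closedBall hz)
  have hχr : ∀ z, χ z ≠ 0 → z ∈ Metric.ball (0 : Spc n × ℝ) 2 := fun z hz => by
    have : z ∈ Function.support χ := hz
    rwa [χ.support_eq] at this
  obtain ⟨s, hs⟩ := exists_nat_ge (m / (1 - θ₁) + m / (1 - θ₂) + (m + 1))
  have h₁' : 0 < 1 - θ₁ := by linarith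
  have h₂' : 0 < 1 - θ₂ := by linarith
  have hm1 : (1 : ℝ) ≤ m := by exact_mod_cast hm
  have q₁ : 0 ≤ m / (1 - θ₁) := by positivity
  have q₂ : 0 ≤ m / (1 - θ₂) := by positivity
  have hsm : m + 1 ≤ s := by exact_mod_cast (show (m : ℝ) + 1 ≤ s by linarith)
  have e₁ : (m : ℝ) ≤ s * (1 - θ₁) := by
    rw [← div_le_iff₀ h₁']; linarith
  have e₂ : (m : ℝ) ≤ s * (1 - θ₂) := by
    rw [← div_le_iff₀ h₂']; linarith
  have hlev : IsLevel χ (Metric.ball 0 1) s s fun z => χ z ^ s :=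
    ⟨le_rfl, ⟨fun _ => 1, contDiff_const, by simp⟩, fun z hz => by simp [hχU z hz]⟩
  have ht : IsLevel χ (Metric.ball 0 1) s (s - 1) (tDeriv n fun z => χ z ^ s) := by
    rw [tDeriv_eq_fderiv ((hlev.contDiff hχ).differentiable (by simp))]
    refine IsLevel.fderiv_apply ?_ hχ Metric.isOpen_ball _
    rwa [Nat.sub_add_cancel (by omega)]
  have hα : ∀ α ∈ mIdx n m,
      IsLevel χ (Metric.ball 0 1) s (s - m) (mDeriv n α fun z => χ z ^ s) := by
    intro α hα
    have hsum : ∑ i, α i = m := (Finset.mem_filter.1 hα).2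
    refine IsLevel.multiDeriv hχ Metric.isOpen_ball α ?_
    rwa [hsum, Nat.sub_add_cancel (by omega)]
  have hχ0 : ∀ z, 0 ≤ χ z := fun z => χ.nonneg
  have hχ1 : ∀ z, χ z ≤ 1 := fun z => χ.le_one
  obtain ⟨C₁, hC₁, hb₁⟩ := ht.exists_abs_le (θ := θ₁) hχ0 hχ1 hχr (by omega) (by
    push_cast [show 1 ≤ s by omega]; nlinarith)
  have hex : ∀ α ∈ mIdx n m, ∃ C, 0 ≤ C ∧
      ∀ z, |mDeriv n α (fun z => χ z ^ s) z| ≤ C * (χ z ^ s) ^ θ₂ := fun α h =>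
    (hα α h).exists_abs_le hχ0 hχ1 hχr (by omega) (by
      push_cast [show m ≤ s by omega]; nlinarith)
  choose! D hD0 hD using hex
  have hDs : 0 ≤ ∑ α ∈ mIdx n m, D α := Finset.sum_nonneg hD0
  have hnn : ∀ (z : Spc n × ℝ) (θ : ℝ), 0 ≤ (χ z ^ s) ^ θ := fun z θ =>
    Real.rpow_nonneg (pow_nonneg (hχ0 z) _) _
  refine ⟨fun z => χ z ^ s, C₁ + ∑ α ∈ mIdx n m, D α, hlev.contDiff hχ, by positivity,
    fun z => pow_nonneg (hχ0 z) s, fun z => pow_le_one₀ (hχ0 z) (hχ1 z),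
    fun z hz => by simp [hχU z hz], fun z hz => ?_, fun z => ?_, fun z hz => ?_,
    fun α h z hz => ?_, fun z => ?_⟩
  · have : χ z = 0 := by_contra fun h => hz (hχr z h)
    simp [this, show s ≠ 0 by omega]
  · exact (hb₁ z).trans (mul_le_mul_of_nonneg_right (by linarith) (hnn z _))
  · rw [ht.2.2 z hz, if_neg (by omega)]
  · rw [(hα α h).2.2 z hz, if_neg (by omega)]
  · calc ∑ α ∈ mIdx n m, |mDeriv n α (fun z => χ z ^ s) z|
        ≤ ∑ α ∈ mIdx n m, D α * (χ z ^ s) ^ θ₂ := Finset.sum_le_sum fun α h => hD α h z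
      _ = (∑ α ∈ mIdx n m, D α) * (χ z ^ s) ^ θ₂ := by rw [Finset.sum_mul]
      _ ≤ _ := mul_le_mul_of_nonneg_right (by linarith) (hnn z _)

/-- The anisotropic dilation `(x, t) ↦ (b x, c t)`. -/
def dil (n : ℕ) (b c : ℝ) (z : Spc n × ℝ) : Spc n × ℝ := (b • z.1, c * z.2)

lemma contDiff_dil (n : ℕ) (b c : ℝ) : ContDiff ℝ (⊤ : ℕ∞) (dil n b c) :=
  (contDiff_fst.const_smul b).prodMk (contDiff_const.mul contDiff_snd)

lemma tDeriv_comp_dil (n : ℕ) (b c : ℝ) (ψ : Spc n × ℝ → ℝ) :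
    tDeriv n (fun z => ψ (dil n b c z)) = fun z => c * tDeriv n ψ (dil n b c z) := by
  funext z
  exact deriv_comp_mul_left c (fun s => ψ (b • z.1, s)) z.2

lemma spDeriv_const_mul_comp_dil (n : ℕ) (i : Fin n) (b c d : ℝ) (ψ : Spc n × ℝ → ℝ) :
    spDeriv n i (fun z => d * ψ (dil n b c z)) =
      fun z => d * b * spDeriv n i ψ (dil n b c z) := by
  funext z
  have := deriv_comp_mul_left b
    (fun s => ψ (b • z.1 + s • EuclideanSpace.single i (1 : ℝ), c * z.2)) 0
  simp only [mul_zero, smul_eq_mul] at this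
  simp only [spDeriv, dil, deriv_const_mul_field', smul_add, smul_smul, this, mul_assoc]

lemma spDeriv_iterate_const_mul_comp_dil (n : ℕ) (i : Fin n) (b c d : ℝ) (k : ℕ)
    (ψ : Spc n × ℝ → ℝ) :
    (spDeriv n i)^[k] (fun z => d * ψ (dil n b c z)) =
      fun z => d * b ^ k * (spDeriv n i)^[k] ψ (dil n b c z) := by
  induction k generalizing d ψ with
  | zero => simp
  | succ k ih =>
    rw [Function.iterate_succ_apply, spDeriv_const_mul_comp_dil, ih]
    funext z
    rw [Function.iterate_succ_apply]
    ring

lemma mDeriv_comp_dil (n : ℕ) (α : Fin n → ℕ) (b c : ℝ) (ψ : Spc n × ℝ → ℝ) :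
    mDeriv n α (fun z => ψ (dil n b c z)) =
      fun z => b ^ (∑ i, α i) * mDeriv n α ψ (dil n b c z) := by
  have key : ∀ l : List (Fin n),
      l.foldr (fun i ψ => (spDeriv n i)^[α i] ψ) (fun z => ψ (dil n b c z)) =
        fun z => b ^ (l.map α).sum *
          l.foldr (fun i ψ => (spDeriv n i)^[α i] ψ) ψ (dil n b c z) := by
    intro l
    induction l with
    | nil => simp
    | cons i l ih =>
      rw [List.foldr_cons, ih, spDeriv_iterate_const_mul_comp_dil]
      simp [pow_add, mul_comm]
  rw [Fin.sum_univ_def]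
  exact key _

lemma dil_preimage_ball (n : ℕ) {R T : ℝ} (hR : 0 < R) (hT : 0 < T) (r : ℝ) :
    dil n R⁻¹ T⁻¹ ⁻¹' Metric.ball 0 r = Metric.ball 0 (R * r) ×ˢ Metric.ball 0 (T * r) := by
  ext z
  simp only [dil, mem_preimage, mem_ball_zero_iff, Prod.norm_def, max_lt_iff, mem_prod,
    norm_smul, norm_mul, norm_inv, Real.norm_eq_abs, abs_of_pos hR, abs_of_pos hT,
    inv_mul_lt_iff₀ hR, inv_mul_lt_iff₀ hT]

lemma volume_real_prod_ball (n : ℕ) {R T : ℝ} (hR : 0 < R) (hT : 0 < T) (r : ℝ) :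
    volume.real (Metric.ball (0 : Spc n) (R * r) ×ˢ Metric.ball (0 : ℝ) (T * r)) =
      R ^ n * T * (volume.real (Metric.ball (0 : Spc n) r) *
        volume.real (Metric.ball (0 : ℝ) r)) := by
  rw [Measure.volume_eq_prod, measureReal_prod_prod,
    measureReal_def, measureReal_def, Measure.addHaar_ball_mul_of_pos volume (0 : Spc n) hR,
    Measure.addHaar_ball_mul_of_pos volume (0 : ℝ) hT, ENNReal.toReal_mul, ENNReal.toReal_mul,
    ENNReal.toReal_ofReal (by positivity), ENNReal.toReal_ofReal (by positivity)]
  simp [measureReal_def]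
  ring

lemma time_scale (n : ℕ) {lam R : ℝ} (hlam : 1 < lam) (hR : 0 < R) :
    ((R ^ (n * (lam - 1)))⁻¹) ^ (1 / (1 - 1 / lam)) * (R ^ n * R ^ (n * (lam - 1))) = 1 := by
  have h0 : lam - 1 ≠ 0 := by linarith
  have h1 : lam ≠ 0 := by linarith
  rw [← Real.rpow_neg hR.le, ← Real.rpow_mul hR.le, ← Real.rpow_natCast, ← Real.rpow_add hR,
    ← Real.rpow_add hR]
  convert Real.rpow_zero R using 2
  rw [one_sub_div h1]
  field_simp
  ring

lemma space_scale (n m : ℕ) (hn : 1 ≤ n) {lam p R : ℝ} (hlam : 1 < lam) (hp : p < lam)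
    (hlam2 : lam ≤ p + (m : ℝ) / (n : ℝ)) (hR : 1 ≤ R) :
    ((R⁻¹) ^ m) ^ (1 / (1 - p / lam)) * (R ^ n * R ^ (n * (lam - 1))) ≤ 1 := by
  have hR0 : 0 < R := by linarith
  have h0 : 0 < lam - p := by linarith
  have h1 : 0 < lam := by linarith
  have hn0 : (0 : ℝ) < n := by exact_mod_cast hn
  have hmn : n * (lam - p) ≤ m := by
    have : lam - p ≤ m / n := by linarith
    rwa [le_div_iff₀ hn0, mul_comm] at this
  rw [inv_pow, ← Real.rpow_natCast R m, ← Real.rpow_neg hR0.le, ← Real.rpow_mul hR0.le,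
    ← Real.rpow_natCast, ← Real.rpow_add hR0, ← Real.rpow_add hR0]
  refine Real.rpow_le_one_of_one_le_of_nonpos hR ?_
  rw [one_sub_div h1.ne', one_div_div]
  have : n * lam ≤ m * (lam / (lam - p)) := by
    rw [← mul_div_assoc, le_div_iff₀ h0]
    nlinarith
  linarith

lemma tendsto_rpow_neg_ratio {θ : ℝ} (h0 : 0 < θ) (h1 : θ < 1) :
    Tendsto (fun k : ℝ => k ^ (-θ / (1 - θ))) atTop (nhds 0) := by
  have : 0 < θ / (1 - θ) := div_pos h0 (by linarith)
  simpa [neg_div] using tendsto_rpow_neg_atTop this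

lemma abs_rpow_mul_rpow {x φ q lam : ℝ} (hφ : 0 ≤ φ) (hlam : lam ≠ 0) :
    |x| ^ q * φ ^ (q / lam) = (|x| ^ lam * φ) ^ (q / lam) := by
  rw [Real.mul_rpow (by positivity) hφ, ← Real.rpow_mul (abs_nonneg x), mul_div_cancel₀ _ hlam]

/-- Integrability on the cylinders gives integrability on bounded boxes of the half-space. -/
lemma integrableOn_prod_ball {n : ℕ} {F : Spc n × ℝ → ℝ}
    (hF : ∀ r : ℝ, 0 < r → IntegrableOn F (cyl n r 1)) {R T : ℝ} (hR : 0 < R) (hT : 0 < T) :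
    IntegrableOn F (Metric.ball (0 : Spc n) R ×ˢ Metric.ball (0 : ℝ) T)
      (volume.restrict (halfSp n)) := by
  rw [IntegrableOn, Measure.restrict_restrict
    (Metric.isOpen_ball.prod Metric.isOpen_ball).measurableSet]
  refine (hF (R + T) (by positivity)).mono_set ?_
  rintro z ⟨⟨h1, h2⟩, h3⟩
  rw [mem_ball_zero_iff, Real.norm_eq_abs] at h2
  refine ⟨Metric.ball_subset_ball (by linarith) h1, h3, ?_⟩
  rw [Real.rpow_one]
  linarith [le_abs_self z.2]

/-- Capacity estimate: the energy `I R = ∫ |u|^λ φ_R` of a solution against a cutoff at scale `R`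
is controlled by its part `J R` where the cutoff is not constant. -/
lemma exists_energy_estimate
    (n m : ℕ) (hn : 1 ≤ n) (hm : 1 ≤ m) (A p : ℝ) (hA : 0 < A) (hp : 0 < p)
    (a : (Fin n → ℕ) → Spc n × ℝ → ℝ → ℝ) (ha : GoodCoeffs n m A p a)
    (u0 : Spc n → ℝ) (hu0nn : ∀ᵐ x ∂(volume : Measure (Spc n)), 0 ≤ u0 x)
    (lam : ℝ) (hlam1 : max 1 p < lam) (hlam2 : lam ≤ p + (m : ℝ) / (n : ℝ))
    (u : Spc n × ℝ → ℝ)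
    (hu : IsGlobalWeakSol n 1 m p a (fun ζ => ζ ^ lam) (fun _ => u0) u) :
    ∃ D I J : ℝ → ℝ, Tendsto D atTop (nhds 0) ∧ ∀ R : ℝ, 1 ≤ R →
      (∀ k, 0 < k → I R ≤ 2 * k * J R + D k) ∧ J R ≤ I R ∧
      (∫ z in Metric.ball 0 R ×ˢ Metric.ball 0 (R ^ (n * (lam - 1))), |u z| ^ lam
        ∂(volume.restrict (halfSp n))) ≤ I R ∧
      (Integrable (fun z => |u z| ^ lam) (volume.restrict (halfSp n)) →
        J R ≤ ∫ z in (Metric.ball 0 R ×ˢ Metric.ball 0 (R ^ (n * (lam - 1))))ᶜ, |u z| ^ lam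
          ∂(volume.restrict (halfSp n))) := by
  obtain ⟨h1l, hpl⟩ := max_lt_iff.1 hlam1
  have hl0 : 0 < lam := by linarith
  have hθ₁ : 0 < 1 / lam := by positivity
  have hθ₂ : 0 < p / lam := by positivity
  have hθ₁' : 1 / lam < 1 := (div_lt_one hl0).2 h1l
  have hθ₂' : p / lam < 1 := (div_lt_one hl0).2 hpl
  obtain ⟨Φ, C, hΦ, hC, hΦ0, hΦ1, hΦU, hΦr, ht, htU, hαU, hα⟩ :=
    exists_cutoff n m hm hθ₁' hθ₂'
  set μ := (volume : Measure (Spc n × ℝ)).restrict (halfSp n) with hμ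
  set V := volume.real (Metric.ball (0 : Spc n) 2) * volume.real (Metric.ball (0 : ℝ) 2)
    with hV
  have hV0 : 0 ≤ V := mul_nonneg measureReal_nonneg measureReal_nonneg
  set κ := n * (lam - 1) with hκ
  let φ : ℝ → Spc n × ℝ → ℝ := fun R z => Φ (dil n R⁻¹ (R ^ κ)⁻¹ z)
  let U : ℝ → Set (Spc n × ℝ) := fun R => Metric.ball 0 R ×ˢ Metric.ball 0 (R ^ κ)
  refine ⟨fun k => k ^ (-(1 / lam) / (1 - 1 / lam)) * (C ^ (1 / (1 - 1 / lam)) * V)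
      + k ^ (-(p / lam) / (1 - p / lam)) * ((A * C) ^ (1 / (1 - p / lam)) * V),
    fun R => ∫ z, |u z| ^ lam * φ R z ∂μ, fun R => ∫ z in (U R)ᶜ, |u z| ^ lam * φ R z ∂μ,
    ?_, fun R hR => ?_⟩
  · simpa using ((tendsto_rpow_neg_ratio hθ₁ hθ₁').mul_const _).add
      ((tendsto_rpow_neg_ratio hθ₂ hθ₂').mul_const _)
  have hR0 : 0 < R := by linarith
  have hT0 : 0 < R ^ κ := Real.rpow_pos_of_pos hR0 _
  set T := R ^ κ with hT
  have hpre := dil_preimage_ball n hR0 hT0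
  set B : Set (Spc n × ℝ) := Metric.ball 0 (R * 2) ×ˢ Metric.ball 0 (T * 2) with hB
  have hBm : MeasurableSet B := (Metric.isOpen_ball.prod Metric.isOpen_ball).measurableSet
  have hUm : MeasurableSet (U R) := (Metric.isOpen_ball.prod Metric.isOpen_ball).measurableSet
  have hUmem : ∀ z ∈ U R, dil n R⁻¹ T⁻¹ z ∈ Metric.ball 0 1 := fun z hz => by
    rw [← mem_preimage, hpre]; simpa only [mul_one] using hz
  have hBmem : ∀ z ∉ B, dil n R⁻¹ T⁻¹ z ∉ Metric.ball 0 2 := fun z hz => by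
    rwa [← mem_preimage, hpre]
  have hφs : ContDiff ℝ (⊤ : ℕ∞) (φ R) := hΦ.comp (contDiff_dil n _ _)
  have hφ0 : ∀ z, 0 ≤ φ R z := fun z => hΦ0 _
  have hφ1 : ∀ z, φ R z ≤ 1 := fun z => hΦ1 _
  have hφU : ∀ z ∈ U R, φ R z = 1 := fun z hz => hΦU _ (hUmem z hz)
  have hφB : ∀ z ∉ B, φ R z = 0 := fun z hz => hΦr _ (hBmem z hz)
  have hF0 : ∀ z, 0 ≤ |u z| ^ lam := fun z => by positivity
  have hX0 : ∀ z, 0 ≤ |u z| ^ lam * φ R z := fun z => mul_nonneg (hF0 z) (hφ0 z)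
  have hXB : ∀ z ∉ B, |u z| ^ lam * φ R z = 0 := fun z hz => by rw [hφB z hz, mul_zero]
  have hXint : Integrable (fun z => |u z| ^ lam * φ R z) μ := by
    refine IntegrableOn.integrable_of_forall_notMem_eq_zero (s := B) ?_ hXB
    refine Integrable.mul_bdd (c := 1) (integrableOn_prod_ball hu.2.2.1 (by positivity)
      (by positivity))
      hφs.continuous.aestronglyMeasurable (.of_forall fun z => ?_)
    rw [Real.norm_eq_abs, abs_of_nonneg (hφ0 z)]
    exact hφ1 z
  have hcomp : HasCompactSupport (φ R) := by
    refine HasCompactSupport.intro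
      ((isCompact_closedBall (0 : Spc n) (R * 2)).prod (isCompact_closedBall (0 : ℝ) (T * 2)))
      fun z hz => hφB z fun hzB => hz ?_
    exact ⟨Metric.ball_subset_closedBall hzB.1, Metric.ball_subset_closedBall hzB.2⟩
  have hBvol : volume B ≠ ⊤ := by
    rw [Measure.volume_eq_prod, hB, Measure.prod_prod]
    exact ENNReal.mul_ne_top measure_ball_lt_top.ne measure_ball_lt_top.ne
  have hBμ : μ B ≠ ⊤ := ((Measure.restrict_apply_le _ _).trans_lt hBvol.lt_top).ne
  have hBreal : μ.real B ≤ R ^ n * T * V := by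
    rw [hV, ← volume_real_prod_ball n hR0 hT0]
    exact ENNReal.toReal_mono hBvol (Measure.restrict_apply_le _ _)
  refine ⟨fun k hk => ?_, ?_, ?_, fun hint => ?_⟩
  · have hweak := hu.2.2.2 (φ R) hφs hcomp hφ0
    have hinit : 0 ≤ ∫ x : Spc n, ∑ i ∈ Finset.range 1,
        (-1 : ℝ) ^ i * u0 x * (tDeriv n)^[i] (φ R) (x, 0) := by
      refine integral_nonneg_of_ae ?_
      filter_upwards [hu0nn] with x hx
      simpa using mul_nonneg hx (hφ0 (x, 0))
    have hb₁ := abs_integral_le_of_le_rpow (μ := μ) (X := fun z => |u z| ^ lam * φ R z)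
      (h := fun z => (-1 : ℝ) ^ 1 * u z * (tDeriv n)^[1] (φ R) z) (s := U R) (t := B)
      (y := C * T⁻¹) hθ₁ hθ₁' hk (by positivity) hUm hBm hBμ hXint hX0 hXB
      (.of_forall fun z => by
        rw [← abs_rpow_mul_rpow (hφ0 z) hl0.ne', Function.iterate_one, tDeriv_comp_dil,
          abs_mul, abs_mul, abs_mul, Real.rpow_one, abs_of_pos (inv_pos.2 hT0)]
        have := mul_le_mul_of_nonneg_left (ht (dil n R⁻¹ T⁻¹ z))
          (mul_nonneg (abs_nonneg (u z)) (inv_nonneg.2 hT0.le))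
        simp only [pow_one, abs_neg, abs_one, one_mul]
        calc _ = |u z| * T⁻¹ * |tDeriv n Φ (dil n R⁻¹ T⁻¹ z)| := by ring
          _ ≤ _ := this
          _ = _ := by ring)
      (fun z hz => by
        rw [Function.iterate_one, tDeriv_comp_dil]
        exact mul_eq_zero_of_right _ (mul_eq_zero_of_right _ (htU _ (hUmem z hz))))
    have hgrow : ∀ᵐ z ∂μ, ∀ α ∈ mIdx n m, |a α z (u z)| ≤ A * |u z| ^ p := by
      rw [Finset.eventually_all]
      intro α h
      filter_upwards [(ha α h).2.2] with z hz using hz (u z)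
    have hscale : ∀ α ∈ mIdx n m, ∀ z, mDeriv n α (φ R) z
        = R⁻¹ ^ m * mDeriv n α Φ (dil n R⁻¹ T⁻¹ z) := fun α h z => by
      rw [mDeriv_comp_dil, show ∑ i, α i = m from (Finset.mem_filter.1 h).2]
    have hb₂ := abs_integral_le_of_le_rpow (μ := μ) (X := fun z => |u z| ^ lam * φ R z)
      (h := fun z => ∑ α ∈ mIdx n m, (-1 : ℝ) ^ m * a α z (u z) * mDeriv n α (φ R) z)
      (s := U R) (t := B) (y := A * C * R⁻¹ ^ m) hθ₂ hθ₂' hk (by positivity) hUm hBm hBμ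
      hXint hX0 hXB
      (by
        filter_upwards [hgrow] with z hz
        rw [← abs_rpow_mul_rpow (hφ0 z) hl0.ne']
        have hRm : 0 ≤ R⁻¹ ^ m := by positivity
        calc |∑ α ∈ mIdx n m, (-1 : ℝ) ^ m * a α z (u z) * mDeriv n α (φ R) z|
            ≤ ∑ α ∈ mIdx n m, |(-1 : ℝ) ^ m * a α z (u z) * mDeriv n α (φ R) z| :=
              Finset.abs_sum_le_sum_abs _ _
          _ ≤ ∑ α ∈ mIdx n m,
                A * |u z| ^ p * R⁻¹ ^ m * |mDeriv n α Φ (dil n R⁻¹ T⁻¹ z)| := by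
              refine Finset.sum_le_sum fun α h => ?_
              rw [hscale α h, abs_mul, abs_mul, abs_mul, abs_pow, abs_neg, abs_one, one_pow,
                one_mul, abs_of_nonneg hRm, ← mul_assoc]
              gcongr
              exact hz α h
          _ = A * |u z| ^ p * R⁻¹ ^ m *
                ∑ α ∈ mIdx n m, |mDeriv n α Φ (dil n R⁻¹ T⁻¹ z)| := by rw [Finset.mul_sum]
          _ ≤ A * |u z| ^ p * R⁻¹ ^ m * (C * φ R z ^ (p / lam)) :=
              mul_le_mul_of_nonneg_left (hα _) (by positivity)
          _ = _ := by ring)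
      (fun z hz => Finset.sum_eq_zero fun α h => by
        rw [hscale α h, hαU α h _ (hUmem z hz), mul_zero, mul_zero])
    have hv₁ : (C * T⁻¹) ^ (1 / (1 - 1 / lam)) * μ.real B
        ≤ C ^ (1 / (1 - 1 / lam)) * V := by
      rw [Real.mul_rpow hC (by positivity), mul_assoc]
      refine mul_le_mul_of_nonneg_left ?_ (by positivity)
      calc T⁻¹ ^ (1 / (1 - 1 / lam)) * μ.real B
          ≤ T⁻¹ ^ (1 / (1 - 1 / lam)) * (R ^ n * T * V) := by gcongr
        _ = T⁻¹ ^ (1 / (1 - 1 / lam)) * (R ^ n * T) * V := by ring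
        _ = V := by rw [hT, hκ, time_scale n h1l hR0, one_mul]
    have hv₂ : (A * C * R⁻¹ ^ m) ^ (1 / (1 - p / lam)) * μ.real B
        ≤ (A * C) ^ (1 / (1 - p / lam)) * V := by
      rw [Real.mul_rpow (by positivity) (by positivity), mul_assoc]
      refine mul_le_mul_of_nonneg_left ?_ (by positivity)
      calc (R⁻¹ ^ m) ^ (1 / (1 - p / lam)) * μ.real B
          ≤ (R⁻¹ ^ m) ^ (1 / (1 - p / lam)) * (R ^ n * T * V) := by gcongr
        _ = (R⁻¹ ^ m) ^ (1 / (1 - p / lam)) * (R ^ n * T) * V := by ring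
        _ ≤ 1 * V := mul_le_mul_of_nonneg_right (space_scale n m hn h1l hpl hlam2 hR) hV0
        _ = V := one_mul V
    have hw₁ := mul_le_mul_of_nonneg_left hv₁
      (Real.rpow_nonneg hk.le (-(1 / lam) / (1 - 1 / lam)))
    have hw₂ := mul_le_mul_of_nonneg_left hv₂
      (Real.rpow_nonneg hk.le (-(p / lam) / (1 - p / lam)))
    rw [mul_assoc (k ^ _)] at hb₁ hb₂
    have e₁ := (abs_le.1 hb₁).2
    have e₂ := (abs_le.1 hb₂).1
    simp only [← hμ] at hweak
    have e₃ : ∫ z, |u z| ^ lam * φ R z ∂μ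
        ≤ (∫ z, (-1 : ℝ) ^ 1 * u z * (tDeriv n)^[1] (φ R) z ∂μ) -
          ∫ z, ∑ α ∈ mIdx n m, (-1 : ℝ) ^ m * a α z (u z) * mDeriv n α (φ R) z ∂μ :=
      (le_add_of_nonneg_left hinit).trans hweak
    calc ∫ z, |u z| ^ lam * φ R z ∂μ
        ≤ _ := e₃
      _ ≤ _ := sub_le_sub (e₁.trans (add_le_add_right hw₁ _))
        ((neg_le_neg (add_le_add_right hw₂ _)).trans e₂)
      _ = _ := by ring
  · exact setIntegral_le_integral hXint (.of_forall hX0)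
  · calc ∫ z in U R, |u z| ^ lam ∂μ = ∫ z in U R, |u z| ^ lam * φ R z ∂μ :=
          setIntegral_congr_fun hUm fun z hz => by simp [hφU z hz]
      _ ≤ _ := setIntegral_le_integral hXint (.of_forall hX0)
  · exact setIntegral_mono hXint.integrableOn hint.integrableOn fun z =>
      mul_le_of_le_one_right (hF0 z) (hφ1 z)

/-- **Example 2.1.** For the parabolic problem `u_t - L u ≥ |u|^λ`, `u(·,0) = u_0 ≥ 0`,
with `max {1, p} < λ ≤ p + m/n`, any global weak solution is trivial. -/
theorem blowup_power_nonlinearity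
    (n m : ℕ) (hn : 1 ≤ n) (hm : 1 ≤ m)
    (A p : ℝ) (hA : 0 < A) (hp : 0 < p)
    (a : (Fin n → ℕ) → Spc n × ℝ → ℝ → ℝ) (ha : GoodCoeffs n m A p a)
    (u0 : Spc n → ℝ) (hu0 : L1locInit n u0)
    (hu0nn : ∀ᵐ x ∂(volume : Measure (Spc n)), 0 ≤ u0 x)
    (lam : ℝ) (hlam1 : max 1 p < lam) (hlam2 : lam ≤ p + (m : ℝ) / (n : ℝ))
    (u : Spc n × ℝ → ℝ)
    (hu : IsGlobalWeakSol n 1 m p a (fun ζ => ζ ^ lam) (fun _ => u0) u) :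
    TrivialSol n u := by
  obtain ⟨h1l, -⟩ := max_lt_iff.1 hlam1
  obtain ⟨D, I, J, hD, hE⟩ :=
    exists_energy_estimate n m hn hm A p hA hp a ha u0 hu0nn lam hlam1 hlam2 u hu
  set μ := (volume : Measure (Spc n × ℝ)).restrict (halfSp n) with hμ
  set κ := n * (lam - 1) with hκ
  have hn0 : (0 : ℝ) < n := by exact_mod_cast hn
  have hκ0 : 0 < κ := mul_pos hn0 (by linarith)
  let R : ℕ → ℝ := fun j => j + 1
  have hR1 : ∀ j, 1 ≤ R j := fun j => by simp [R]
  have hR0 : ∀ j, 0 < R j := fun j => one_pos.trans_le (hR1 j)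
  have hRt : Tendsto R atTop atTop :=
    tendsto_atTop_add_const_right _ _ tendsto_natCast_atTop_atTop
  let U : ℕ → Set (Spc n × ℝ) := fun j => Metric.ball 0 (R j) ×ˢ Metric.ball 0 (R j ^ κ)
  have hUm : ∀ j, MeasurableSet (U j) := fun j =>
    (Metric.isOpen_ball.prod Metric.isOpen_ball).measurableSet
  have hcov : AECover μ atTop U := by
    refine ⟨.of_forall fun z => ?_, hUm⟩
    filter_upwards [hRt.eventually_gt_atTop ‖z.1‖,
      ((tendsto_rpow_atTop hκ0).comp hRt).eventually_gt_atTop ‖z.2‖] with j h1 h2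
    exact ⟨mem_ball_zero_iff.2 h1, mem_ball_zero_iff.2 h2⟩
  have hF0 : ∀ z, 0 ≤ |u z| ^ lam := fun z => by positivity
  have hint : Integrable (fun z => |u z| ^ lam) μ := by
    refine hcov.integrable_of_integral_norm_bounded (2 * D (1 / 4)) (fun j =>
      integrableOn_prod_ball hu.2.2.1 (hR0 j) (Real.rpow_pos_of_pos (hR0 j) _))
      (.of_forall fun j => ?_)
    obtain ⟨h1, h2, h3, -⟩ := hE (R j) (hR1 j)
    simp only [Real.norm_eq_abs, abs_of_nonneg (hF0 _)]
    linarith [h1 (1 / 4) (by norm_num)]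
  have hlim := hcov.integral_tendsto_of_countably_generated hint
  have hbound : ∀ k : ℝ, 0 < k → ∫ z, |u z| ^ lam ∂μ ≤ D k := by
    intro k hk
    have hr : Tendsto (fun j => 2 * k * ((∫ z, |u z| ^ lam ∂μ) - ∫ z in U j, |u z| ^ lam ∂μ)
        + D k) atTop (nhds (D k)) := by
      simpa using ((hlim.const_sub (∫ z, |u z| ^ lam ∂μ)).const_mul (2 * k)).add_const (D k)
    refine le_of_tendsto_of_tendsto' hlim hr fun j => ?_
    obtain ⟨h1, -, h3, h4⟩ := hE (R j) (hR1 j)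
    rw [← setIntegral_compl₀ (hUm j).nullMeasurableSet hint]
    exact h3.trans ((h1 k hk).trans
      (add_le_add_left (mul_le_mul_of_nonneg_left (h4 hint) (by positivity)) _))
  have hzero : ∫ z, |u z| ^ lam ∂μ = 0 :=
    le_antisymm (ge_of_tendsto hD ((eventually_gt_atTop 0).mono hbound))
      (integral_nonneg hF0)
  filter_upwards [(integral_eq_zero_iff_of_nonneg hF0 hint).1 hzero] with z hz
  exact abs_eq_zero.1 (((Real.rpow_eq_zero (abs_nonneg _) (by linarith)).1 hz))
end
end

section
/- For every κ > 0 there exists a constant C > 0, depending only on A, k, m, n, p and κ, such that for every global weak solution u of the problem and all real numbers R > 0 and R ≤ r_1 < r_2 ≤ 2R one has (r_2^κ − r_1^κ)^{−k} ∫_{r_1^κ}^{r_2^κ} ∫_{B_{r_2}} |u| dx dt + (r_2 − r_1)^{−m} ∫_0^{r_2^κ} ∫_{B_{r_2} \ B_{r_1}} |u|^p dx dt ≥ C ∫_{Q_{r_1}^κ} f(|u|) dx dt. -/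
open MeasureTheory Real Set Filter

noncomputable section

/-- The standing hypotheses of Section 3: the coefficients are Caratheodory functions
with the growth bound, `f` satisfies the monotonicity/convexity/positivity conditions
together with (1.4) and (1.5), and the initial data are locally integrable with
`u_{k-1} ≥ 0` a.e. -/
def Standing (n k m : ℕ) (A p : ℝ) (a : (Fin n → ℕ) → Spc n × ℝ → ℝ → ℝ)
    (f : ℝ → ℝ) (u0 : ℕ → Spc n → ℝ) : Prop :=
  GoodCoeffs n m A p a ∧ GoodF p f ∧
  (∀ i < k, L1locInit n (u0 i)) ∧
  (∀ᵐ x ∂(volume : Measure (Spc n)), 0 ≤ u0 (k - 1) x) ∧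
  Cond14 k f ∧ Cond15 m p f

/-- A smooth radial cutoff: it equals `1` near the closed ball of radius `a` and vanishes near the
complement of the open ball of radius `b`. -/
def radialCutoff (E : Type*) [NormedAddCommGroup E] (a b : ℝ) (x : E) : ℝ :=
  Real.smoothTransition (2 - 3 * ((‖x‖ ^ 2 - a ^ 2) / (b ^ 2 - a ^ 2)))

section RadialCutoff

variable {E : Type*} [NormedAddCommGroup E]

lemma radialCutoff_nonneg (a b : ℝ) (x : E) : 0 ≤ radialCutoff E a b x :=
  Real.smoothTransition.nonneg _

lemma radialCutoff_le_one (a b : ℝ) (x : E) : radialCutoff E a b x ≤ 1 :=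
  Real.smoothTransition.le_one _

lemma radialCutoff_eventuallyEq_one {a b : ℝ} (ha : 0 < a) (hab : a < b) {x : E} (hx : ‖x‖ ≤ a) :
    radialCutoff E a b =ᶠ[nhds x] fun _ => 1 := by
  have hd : 0 < b ^ 2 - a ^ 2 := by nlinarith
  have hc : Continuous fun y : E => (‖y‖ ^ 2 - a ^ 2) / (b ^ 2 - a ^ 2) := by fun_prop
  have h0 : (‖x‖ ^ 2 - a ^ 2) / (b ^ 2 - a ^ 2) < 1 / 3 := by
    rw [div_lt_iff₀ hd]
    nlinarith [norm_nonneg x]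
  filter_upwards [hc.continuousAt.eventually_lt_const h0] with y hy
  exact Real.smoothTransition.one_of_one_le (by linarith)

lemma radialCutoff_eventuallyEq_zero {a b : ℝ} (ha : 0 < a) (hab : a < b) {x : E} (hx : b ≤ ‖x‖) :
    radialCutoff E a b =ᶠ[nhds x] fun _ => 0 := by
  have hd : 0 < b ^ 2 - a ^ 2 := by nlinarith
  have hc : Continuous fun y : E => (‖y‖ ^ 2 - a ^ 2) / (b ^ 2 - a ^ 2) := by fun_prop
  have h0 : 2 / 3 < (‖x‖ ^ 2 - a ^ 2) / (b ^ 2 - a ^ 2) := by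
    rw [lt_div_iff₀ hd]
    nlinarith [norm_nonneg x]
  filter_upwards [hc.continuousAt.eventually_const_lt h0] with y hy
  exact Real.smoothTransition.zero_of_nonpos (by linarith)

variable [InnerProductSpace ℝ E]

lemma contDiff_radialCutoff (a b : ℝ) : ContDiff ℝ (⊤ : ℕ∞) (radialCutoff E a b) := by
  have h : ContDiff ℝ (⊤ : ℕ∞) fun x : E => 2 - 3 * ((‖x‖ ^ 2 - a ^ 2) / (b ^ 2 - a ^ 2)) :=
    contDiff_const.sub (contDiff_const.mul (((contDiff_norm_sq ℝ).sub contDiff_const).div_const _))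
  exact Real.smoothTransition.contDiff.comp h

lemma iteratedFDeriv_radialCutoff_eq_zero {a b : ℝ} (ha : 0 < a) (hab : a < b) {j : ℕ}
    (hj : j ≠ 0) {x : E} (hx : ‖x‖ ≤ a ∨ b ≤ ‖x‖) :
    iteratedFDeriv ℝ j (radialCutoff E a b) x = 0 := by
  rcases hx with hx | hx
  · rw [((radialCutoff_eventuallyEq_one ha hab hx).iteratedFDeriv ℝ j).eq_of_nhds,
      iteratedFDeriv_const_of_ne hj]
    rfl
  · rw [((radialCutoff_eventuallyEq_zero ha hab hx).iteratedFDeriv ℝ j).eq_of_nhds,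
      iteratedFDeriv_const_of_ne hj]
    rfl

/-- The derivatives of the argument of the transition function scale like powers of
`2 / (b - a)` inside the ball of radius `b`. -/
lemma norm_iteratedFDeriv_normalizedNormSq_le {a b : ℝ} (ha : 0 < a) (hab : a < b) {x : E}
    (hx : ‖x‖ ≤ b) {i : ℕ} (hi : 1 ≤ i) :
    ‖iteratedFDeriv ℝ i (fun y : E => (‖y‖ ^ 2 - a ^ 2) / (b ^ 2 - a ^ 2)) x‖
      ≤ (2 / (b - a)) ^ i := by
  have hd : 0 < b ^ 2 - a ^ 2 := by nlinarith
  have hba : 0 < b - a := by linarith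
  set c : ℝ := (b ^ 2 - a ^ 2)⁻¹ with hc
  have hc0 : 0 < c := inv_pos.2 hd
  set L : E →L[ℝ] E →L[ℝ] ℝ := (2 * c) • innerSL ℝ with hL
  have hf : fderiv ℝ (fun y : E => (‖y‖ ^ 2 - a ^ 2) / (b ^ 2 - a ^ 2)) = L := by
    ext1 y
    have h := (((hasStrictFDerivAt_norm_sq y).hasFDerivAt.sub_const (a ^ 2)).mul_const c)
    have h' := h.fderiv
    simp only [div_eq_mul_inv, ← hc]
    rw [h']
    ext v
    change c * (2 • inner ℝ y v) = 2 * c * inner ℝ y v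
    rw [nsmul_eq_mul]
    push_cast
    ring
  have hLx : ∀ y, ‖L y‖ = 2 * c * ‖y‖ := fun y => by
    have h : L y = (2 * c) • innerSL ℝ y := rfl
    rw [h, norm_smul, Real.norm_of_nonneg (by positivity)]
    exact congrArg _ (innerSL_apply_norm ℝ y)
  have hLn : ‖L‖ ≤ (2 / (b - a)) ^ 2 := by
    refine (L.opNorm_le_bound (by positivity) fun y => (hLx y).le).trans ?_
    rw [hc, div_pow, ← div_eq_mul_inv, div_le_div_iff₀ hd (by positivity)]
    nlinarith
  obtain ⟨j, rfl⟩ : ∃ j, i = j + 1 := ⟨i - 1, by omega⟩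
  rw [← norm_iteratedFDeriv_fderiv, hf]
  match j with
  | 0 =>
    rw [norm_iteratedFDeriv_zero]
    rw [hLx, zero_add, pow_one, hc]
    have : 2 * (b ^ 2 - a ^ 2)⁻¹ * ‖x‖ = 2 * ‖x‖ / (b ^ 2 - a ^ 2) := by
      rw [div_eq_mul_inv]; ring
    rw [this, div_le_div_iff₀ hd hba]
    nlinarith [norm_nonneg x]
  | j + 1 =>
    rw [← norm_iteratedFDeriv_fderiv]
    have hfL : fderiv ℝ (L : E → E →L[ℝ] ℝ) = fun _ => L := by
      ext1 y
      exact L.fderiv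
    rw [hfL]
    match j with
    | 0 =>
      rw [norm_iteratedFDeriv_zero]
      exact hLn
    | j + 1 =>
      rw [iteratedFDeriv_succ_const]
      simp only [Pi.zero_apply, norm_zero]
      positivity

/-- The derivatives of order `j ≥ 1` of the cutoff are bounded by `K / (b - a) ^ j` with `K`
independent of the radii. -/
lemma exists_norm_iteratedFDeriv_radialCutoff_le (E : Type*) [NormedAddCommGroup E]
    [InnerProductSpace ℝ E] {j : ℕ} (hj : j ≠ 0) :
    ∃ K : ℝ, 0 ≤ K ∧ ∀ a b : ℝ, 0 < a → a < b → ∀ x : E,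
      ‖iteratedFDeriv ℝ j (radialCutoff E a b) x‖ ≤ K / (b - a) ^ j := by
  set χ : ℝ → ℝ := fun s => Real.smoothTransition (2 - 3 * s) with hχ
  have hχs : ContDiff ℝ (⊤ : ℕ∞) χ :=
    Real.smoothTransition.contDiff.comp
      (contDiff_const.sub (contDiff_const.mul contDiff_id))
  have hb : ∀ i : ℕ, ∃ M : ℝ, ∀ s ∈ Icc (0 : ℝ) 1, ‖iteratedFDeriv ℝ i χ s‖ ≤ M := fun i =>
    isCompact_Icc.exists_bound_of_continuousOn
      (hχs.continuous_iteratedFDeriv (m := i) (mod_cast le_top)).continuousOn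
  choose M hM using hb
  set C : ℝ := ∑ i ∈ Finset.range (j + 1), |M i| with hC
  have hC0 : 0 ≤ C := Finset.sum_nonneg fun _ _ => abs_nonneg _
  refine ⟨j.factorial * C * 2 ^ j, by positivity, fun a b ha hab x => ?_⟩
  have hba : 0 < b - a := by linarith
  have hd : 0 < b ^ 2 - a ^ 2 := by nlinarith
  by_cases hx : ‖x‖ ≤ a ∨ b ≤ ‖x‖
  · rw [iteratedFDeriv_radialCutoff_eq_zero ha hab hj hx, norm_zero]
    positivity
  · push Not at hx
    have hg : ContDiff ℝ (⊤ : ℕ∞) fun y : E => (‖y‖ ^ 2 - a ^ 2) / (b ^ 2 - a ^ 2) :=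
      ((contDiff_norm_sq ℝ).sub contDiff_const).div_const _
    have hmem : (‖x‖ ^ 2 - a ^ 2) / (b ^ 2 - a ^ 2) ∈ Icc (0 : ℝ) 1 := by
      constructor
      · exact div_nonneg (by nlinarith) hd.le
      · rw [div_le_one hd]
        nlinarith [norm_nonneg x]
    have key := norm_iteratedFDeriv_comp_le hχs hg (n := j) (mod_cast le_top) x (C := C)
      (D := 2 / (b - a))
      (fun i hi => (hM i _ hmem).trans ((le_abs_self _).trans
        (Finset.single_le_sum (f := fun i => |M i|) (fun _ _ => abs_nonneg _)
          (Finset.mem_range.2 (by omega)))))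
      (fun i hi _ => norm_iteratedFDeriv_normalizedNormSq_le ha hab hx.2.le hi)
    calc _ ≤ _ := key
      _ = _ := by rw [div_pow]; ring

lemma hasCompactSupport_radialCutoff [FiniteDimensional ℝ E] {a b : ℝ} (ha : 0 < a)
    (hab : a < b) : HasCompactSupport (radialCutoff E a b) := by
  have : ProperSpace E := FiniteDimensional.proper ℝ E
  refine HasCompactSupport.intro (isCompact_closedBall (0 : E) b) fun x hx => ?_
  rw [Metric.mem_closedBall, dist_zero_right, not_le] at hx
  exact (radialCutoff_eventuallyEq_zero ha hab hx.le).eq_of_nhds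

end RadialCutoff

/-- `h` is the `j`-th derivative of `ψ` along `j` fixed directions of norm at most one. -/
def IsIteratedDirDeriv {E : Type*} [NormedAddCommGroup E] [NormedSpace ℝ E] (ψ : E → ℝ) (j : ℕ)
    (h : E → ℝ) : Prop :=
  ∃ v : Fin j → E, (∀ i, ‖v i‖ ≤ 1) ∧ ∀ x, h x = iteratedFDeriv ℝ j ψ x v

section DirDeriv

variable {E : Type*} [NormedAddCommGroup E] [NormedSpace ℝ E] {ψ h : E → ℝ} {j : ℕ}

lemma IsIteratedDirDeriv.zero (ψ : E → ℝ) : IsIteratedDirDeriv ψ 0 ψ :=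
  ⟨Fin.elim0, fun i => i.elim0, fun x => by simp⟩

lemma IsIteratedDirDeriv.abs_le (hh : IsIteratedDirDeriv ψ j h) (x : E) :
    |h x| ≤ ‖iteratedFDeriv ℝ j ψ x‖ := by
  obtain ⟨v, hv, hx⟩ := hh
  rw [hx, ← Real.norm_eq_abs]
  refine (ContinuousMultilinearMap.le_opNorm _ _).trans ?_
  exact mul_le_of_le_one_right (norm_nonneg _)
    (Finset.prod_le_one (fun i _ => norm_nonneg _) fun i _ => hv i)

lemma IsIteratedDirDeriv.lineDeriv (hψ : ContDiff ℝ (⊤ : ℕ∞) ψ) (hh : IsIteratedDirDeriv ψ j h)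
    {e : E} (he : ‖e‖ ≤ 1) : IsIteratedDirDeriv ψ (j + 1) fun x => lineDeriv ℝ h x e := by
  obtain ⟨v, hv, hx⟩ := hh
  refine ⟨Fin.cons e v, fun i => ?_, fun x => ?_⟩
  · refine Fin.cases ?_ (fun i => ?_) i
    · simpa using he
    · simpa using hv i
  · have hd : DifferentiableAt ℝ (iteratedFDeriv ℝ j ψ) x :=
      (hψ.differentiable_iteratedFDeriv (mod_cast ENat.natCast_lt_top j)) x
    have hh' : h = fun x => iteratedFDeriv ℝ j ψ x v := funext hx
    have hF : HasFDerivAt h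
        ((ContinuousMultilinearMap.apply ℝ (fun _ : Fin j => E) ℝ v).comp
          (fderiv ℝ (iteratedFDeriv ℝ j ψ) x)) x := by
      rw [hh']
      exact (ContinuousMultilinearMap.apply ℝ (fun _ : Fin j => E) ℝ v).hasFDerivAt.comp x
        hd.hasFDerivAt
    simp only
    rw [iteratedFDeriv_succ_apply_left, (hF.hasLineDerivAt e).lineDeriv]
    simp

end DirDeriv

lemma iterate_tDeriv_prod (n : ℕ) (ψ : Spc n → ℝ) (η : ℝ → ℝ) (j : ℕ) :
    (tDeriv n)^[j] (fun z => ψ z.1 * η z.2) = fun z => ψ z.1 * iteratedDeriv j η z.2 := by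
  induction j with
  | zero => simp
  | succ j ih =>
    rw [Function.iterate_succ_apply', ih]
    funext z
    simp only [tDeriv, deriv_const_mul_field, iteratedDeriv_succ]

/-- Spatial derivatives of a product `ψ(x) η(t)` only act on `ψ`. -/
lemma exists_mDeriv_prod {n : ℕ} {ψ : Spc n → ℝ} (hψ : ContDiff ℝ (⊤ : ℕ∞) ψ) (η : ℝ → ℝ)
    (α : Fin n → ℕ) :
    ∃ h : Spc n → ℝ, IsIteratedDirDeriv ψ (∑ i, α i) h ∧
      mDeriv n α (fun z => ψ z.1 * η z.2) = fun z => h z.1 * η z.2 := by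
  have step : ∀ (i : Fin n) (h : Spc n → ℝ),
      spDeriv n i (fun z => h z.1 * η z.2)
        = fun z => lineDeriv ℝ h z.1 (EuclideanSpace.single i (1 : ℝ)) * η z.2 := by
    intro i h
    funext z
    simp only [spDeriv, deriv_mul_const_field, lineDeriv]
  have iter : ∀ (i : Fin n) (q j : ℕ) (h : Spc n → ℝ), IsIteratedDirDeriv ψ j h →
      ∃ h' : Spc n → ℝ, IsIteratedDirDeriv ψ (q + j) h' ∧
        (spDeriv n i)^[q] (fun z => h z.1 * η z.2) = fun z => h' z.1 * η z.2 := by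
    intro i q j h hh
    induction q with
    | zero => exact ⟨h, by simpa using hh, rfl⟩
    | succ q ih =>
      obtain ⟨h', hh', he⟩ := ih
      refine ⟨fun x => lineDeriv ℝ h' x (EuclideanSpace.single i (1 : ℝ)), ?_,
        by rw [Function.iterate_succ_apply', he, step]⟩
      have := hh'.lineDeriv hψ (e := EuclideanSpace.single i (1 : ℝ)) (by simp)
      rwa [show q + 1 + j = q + j + 1 by ring]
  have fold : ∀ l : List (Fin n), ∃ h : Spc n → ℝ, IsIteratedDirDeriv ψ (l.map α).sum h ∧
      l.foldr (fun i ψ => (spDeriv n i)^[α i] ψ) (fun z => ψ z.1 * η z.2)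
        = fun z => h z.1 * η z.2 := by
    intro l
    induction l with
    | nil => exact ⟨ψ, IsIteratedDirDeriv.zero ψ, rfl⟩
    | cons i l ih =>
      obtain ⟨h, hh, he⟩ := ih
      obtain ⟨h', hh', he'⟩ := iter i (α i) _ h hh
      exact ⟨h', by simpa using hh', by rw [List.foldr_cons, he, he']⟩
  obtain ⟨h, hh, he⟩ := fold (List.finRange n)
  refine ⟨h, ?_, he⟩
  have hs : ((List.finRange n).map α).sum = ∑ i, α i := by
    rw [← List.ofFn_eq_map, List.sum_ofFn]
  rwa [hs] at hh

lemma GoodF.nonneg {p : ℝ} {f : ℝ → ℝ} (hf : GoodF p f) {ζ : ℝ} (hζ : 0 ≤ ζ) : 0 ≤ f ζ := by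
  obtain ⟨-, hc, -, -, hpos⟩ := hf
  rcases hζ.eq_or_lt with rfl | h
  · by_contra! h0
    have h1 := hpos 1 one_pos
    have hd : 0 < 2 * (f 1 - f 0) := by linarith
    set s : ℝ := -f 0 / (2 * (f 1 - f 0)) with hs
    have hs0 : 0 < s := div_pos (by linarith) hd
    have hs1 : s ≤ 1 := by rw [hs, div_le_one hd]; linarith
    have hsm : s * (2 * (f 1 - f 0)) = -f 0 := div_mul_cancel₀ _ hd.ne'
    have h2 := hc.2 (mem_Ici.2 le_rfl) (mem_Ici.2 (zero_le_one' ℝ))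
      (show 0 ≤ 1 - s by linarith) hs0.le (by ring)
    simp only [smul_eq_mul, mul_zero, mul_one, zero_add] at h2
    have h3 := hpos s hs0
    nlinarith
  · exact (hpos ζ h).le

lemma measurableSet_halfSp (n : ℕ) : MeasurableSet (halfSp n) :=
  measurableSet_lt measurable_const measurable_snd

lemma abs_setIntegral_halfSp_le {n : ℕ} {g w : Spc n × ℝ → ℝ} {S : Set (Spc n × ℝ)} {c : ℝ}
    (hS : MeasurableSet S) (hSh : S ⊆ halfSp n) (hw : IntegrableOn w S)
    (hin : ∀ᵐ z ∂(volume.restrict (halfSp n)), z ∈ S → |g z| ≤ c * w z)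
    (hout : ∀ z ∈ halfSp n, z ∉ S → g z = 0) :
    |∫ z in halfSp n, g z| ≤ c * ∫ z in S, w z := by
  have hint : Integrable (S.indicator fun z => c * w z) (volume.restrict (halfSp n)) :=
    ((integrable_indicator_iff hS).2 (hw.const_mul c)).integrableOn
  have h := norm_integral_le_of_norm_le hint (f := g) (by
    filter_upwards [hin, ae_restrict_mem (measurableSet_halfSp n)] with z hz hzh
    by_cases hzS : z ∈ S
    · simpa [hzS] using hz hzS
    · simp [hzS, hout z hzh hzS])
  rwa [setIntegral_indicator hS, inter_eq_self_of_subset_right hSh, integral_const_mul,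
    Real.norm_eq_abs] at h

/-- **Lemma 3.1.** For every `κ > 0` there is a constant `C > 0`, depending only on
`A, k, m, n, p, κ`, such that for every global weak solution `u` and all
`R ≤ r₁ < r₂ ≤ 2R`,
`(r₂^κ - r₁^κ)^{-k} ∫∫ |u| + (r₂ - r₁)^{-m} ∫∫ |u|^p ≥ C ∫_{Q_{r₁}^κ} f(|u|)`. -/
theorem lemma_3_1
    (n k m : ℕ) (hn : 1 ≤ n) (hk : 1 ≤ k) (hm : 1 ≤ m)
    (A p : ℝ) (hA : 0 < A) (hp : 0 < p) (κ : ℝ) (hκ : 0 < κ) :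
    ∃ C : ℝ, 0 < C ∧
      ∀ (a : (Fin n → ℕ) → Spc n × ℝ → ℝ → ℝ) (f : ℝ → ℝ) (u0 : ℕ → Spc n → ℝ)
        (u : Spc n × ℝ → ℝ), Standing n k m A p a f u0 →
        IsGlobalWeakSol n k m p a f u0 u →
        ∀ R r₁ r₂ : ℝ, 0 < R → R ≤ r₁ → r₁ < r₂ → r₂ ≤ 2 * R →
          C * (∫ z in cyl n r₁ κ, f |u z|) ≤
            (∫ z in ball0 n r₂ ×ˢ Ioo (r₁ ^ κ) (r₂ ^ κ), |u z|) / (r₂ ^ κ - r₁ ^ κ) ^ k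
            + (∫ z in (ball0 n r₂ \ ball0 n r₁) ×ˢ Ioo 0 (r₂ ^ κ), |u z| ^ p)
              / (r₂ - r₁) ^ m := by
  obtain ⟨Kt, hKt0, hKt⟩ := exists_norm_iteratedFDeriv_radialCutoff_le ℝ (j := k) (by omega)
  obtain ⟨Kx, hKx0, hKx⟩ := exists_norm_iteratedFDeriv_radialCutoff_le (Spc n) (j := m) (by omega)
  set N : ℝ := ((mIdx n m).card : ℝ) with hN
  have hN0 : 0 ≤ N := Nat.cast_nonneg _
  set K : ℝ := Kt + N * A * Kx + 1 with hK
  have hNAK : 0 ≤ N * A * Kx := by positivity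
  have hK0 : 0 < K := by linarith
  refine ⟨K⁻¹, inv_pos.2 hK0, ?_⟩
  intro a f u0 u hst hsol R r₁ r₂ hR hRr hr _
  obtain ⟨ha, hf, -, hu0, -, -⟩ := hst
  obtain ⟨hu, hup, hfu, hweak⟩ := hsol
  have hr1 : 0 < r₁ := hR.trans_le hRr
  have hr2 : 0 < r₂ := hr1.trans hr
  have hT1 : 0 < r₁ ^ κ := Real.rpow_pos_of_pos hr1 κ
  have hT : r₁ ^ κ < r₂ ^ κ := Real.rpow_lt_rpow hr1.le hr hκ
  set T₁ : ℝ := r₁ ^ κ with hT₁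
  set T₂ : ℝ := r₂ ^ κ with hT₂
  have hT2 : 0 < T₂ := hT1.trans hT
  set ψ : Spc n → ℝ := radialCutoff (Spc n) r₁ r₂ with hψ
  set η : ℝ → ℝ := radialCutoff ℝ T₁ T₂ with hη
  set φ : Spc n × ℝ → ℝ := fun z => ψ z.1 * η z.2 with hφ
  have hψs : ContDiff ℝ (⊤ : ℕ∞) ψ := contDiff_radialCutoff _ _
  have hηs : ContDiff ℝ (⊤ : ℕ∞) η := contDiff_radialCutoff _ _
  have hφs : ContDiff ℝ (⊤ : ℕ∞) φ := (hψs.comp contDiff_fst).mul (hηs.comp contDiff_snd)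
  have hψ0 : ∀ x, 0 ≤ ψ x := radialCutoff_nonneg _ _
  have hψ1 : ∀ x, ψ x ≤ 1 := radialCutoff_le_one _ _
  have hη0 : ∀ t, 0 ≤ η t := radialCutoff_nonneg _ _
  have hη1 : ∀ t, η t ≤ 1 := radialCutoff_le_one _ _
  have hφ0 : ∀ z, 0 ≤ φ z := fun z => mul_nonneg (hψ0 _) (hη0 _)
  have hφ1 : ∀ z, φ z ≤ 1 := fun z => mul_le_one₀ (hψ1 _) (hη0 _) (hη1 _)
  have hψz : ∀ x, r₂ ≤ ‖x‖ → ψ x = 0 := fun x hx =>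
    (radialCutoff_eventuallyEq_zero hr1 hr hx).eq_of_nhds
  have hηz : ∀ t, T₂ ≤ ‖t‖ → η t = 0 := fun t ht =>
    (radialCutoff_eventuallyEq_zero hT1 hT ht).eq_of_nhds
  have hψo : ∀ x, ‖x‖ ≤ r₁ → ψ x = 1 := fun x hx =>
    (radialCutoff_eventuallyEq_one hr1 hr hx).eq_of_nhds
  have hηo : ∀ t, ‖t‖ ≤ T₁ → η t = 1 := fun t ht =>
    (radialCutoff_eventuallyEq_one hT1 hT ht).eq_of_nhds
  have hφc : HasCompactSupport φ := by
    refine HasCompactSupport.intro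
      ((isCompact_closedBall (0 : Spc n) r₂).prod (isCompact_closedBall (0 : ℝ) T₂))
      fun z hz => ?_
    rw [mem_prod, Metric.mem_closedBall, Metric.mem_closedBall, dist_zero_right,
      dist_zero_right, not_and_or, not_le, not_le] at hz
    rcases hz with h | h
    · simp [hφ, hψz _ h.le]
    · simp [hφ, hηz _ h.le]
  have hmain := hweak φ hφs hφc hφ0
  set ρ : ℝ := max r₂ T₂ with hρ
  have hρ0 : 0 < ρ := hr2.trans_le (le_max_left _ _)
  have hsub : ball0 n r₂ ×ˢ Ioo 0 T₂ ⊆ cyl n ρ 1 := by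
    rw [cyl, Real.rpow_one]
    exact prod_mono (Metric.ball_subset_ball (le_max_left _ _))
      (Ioo_subset_Ioo_right (le_max_right _ _))
  have hballm : ∀ r : ℝ, MeasurableSet (ball0 n r) := fun r => measurableSet_ball
  have hmem : ∀ (x : Spc n) (r : ℝ), x ∈ ball0 n r ↔ ‖x‖ < r := fun x r => mem_ball_zero_iff
  -- the initial data contribute a nonnegative term
  have hinit : 0 ≤ ∫ x : Spc n, ∑ i ∈ Finset.range k,
      (-1 : ℝ) ^ i * u0 (k - 1 - i) x * (tDeriv n)^[i] φ (x, 0) := by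
    refine integral_nonneg_of_ae ?_
    filter_upwards [hu0] with x hx
    refine Finset.sum_nonneg fun i _ => ?_
    rw [hφ, iterate_tDeriv_prod]
    rcases Nat.eq_zero_or_pos i with rfl | hi
    · simpa using mul_nonneg hx (mul_nonneg (hψ0 x) (hη0 0))
    · have h0 : iteratedDeriv i η 0 = 0 := by
        rw [iteratedDeriv_eq_iteratedFDeriv,
          iteratedFDeriv_radialCutoff_eq_zero hT1 hT hi.ne' (Or.inl (by simpa using hT1.le))]
        rfl
      simp [h0]
  -- the source term dominates its integral over the inner cylinder
  have hsource : ∫ z in cyl n r₁ κ, f |u z| ≤ ∫ z in halfSp n, f |u z| * φ z := by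
    have hcm : MeasurableSet (cyl n ρ 1) := (hballm _).prod measurableSet_Ioo
    have hintS : IntegrableOn (fun z => f |u z| * φ z) (cyl n ρ 1) := by
      refine (hfu ρ hρ0).mul_bdd (c := 1) hφs.continuous.aestronglyMeasurable ?_
      exact Eventually.of_forall fun z => by
        rw [Real.norm_of_nonneg (hφ0 z)]
        exact hφ1 z
    have hint : IntegrableOn (fun z => f |u z| * φ z) (halfSp n) := by
      refine hintS.of_forall_sdiff_eq_zero (measurableSet_halfSp n) fun z hz => ?_
      have hz' : z ∉ ball0 n r₂ ×ˢ Ioo 0 T₂ := fun h => hz.2 (hsub h)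
      have hpos : 0 < z.2 := hz.1
      rw [mem_prod, hmem, mem_Ioo, not_and_or, not_lt] at hz'
      rcases hz' with h | h
      · simp [hφ, hψz _ h]
      · have : T₂ ≤ ‖z.2‖ := by
          rw [Real.norm_of_nonneg hpos.le]
          by_contra! h'
          exact h ⟨hpos, h'⟩
        simp [hφ, hηz _ this]
    have hle : ∫ z in cyl n r₁ κ, f |u z| * φ z ≤ ∫ z in halfSp n, f |u z| * φ z := by
      refine setIntegral_mono_set hint ?_ (LE.le.eventuallyLE fun z hz => hz.2.1)
      exact Eventually.of_forall fun z => mul_nonneg (hf.nonneg (abs_nonneg _)) (hφ0 z)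
    refine le_trans (le_of_eq ?_) hle
    refine setIntegral_congr_fun ((hballm _).prod measurableSet_Ioo) fun z hz => ?_
    have h1 : ‖z.1‖ < r₁ := (hmem _ _).1 hz.1
    have h2 : ‖z.2‖ ≤ T₁ := by
      rw [Real.norm_of_nonneg hz.2.1.le]
      exact hz.2.2.le
    simp [hφ, hψo _ h1.le, hηo _ h2]
  -- the time derivative lives in the outer layer
  have htime : |∫ z in halfSp n, (-1 : ℝ) ^ k * u z * (tDeriv n)^[k] φ z|
      ≤ Kt / (T₂ - T₁) ^ k * ∫ z in ball0 n r₂ ×ˢ Ioo T₁ T₂, |u z| := by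
    rw [hφ, iterate_tDeriv_prod]
    have hsub' : ball0 n r₂ ×ˢ Ioo T₁ T₂ ⊆ ball0 n r₂ ×ˢ Ioo 0 T₂ :=
      prod_mono le_rfl (Ioo_subset_Ioo_left hT1.le)
    have habs : ∀ t, |iteratedDeriv k η t| ≤ Kt / (T₂ - T₁) ^ k := fun t => by
      rw [← Real.norm_eq_abs, ← norm_iteratedFDeriv_eq_norm_iteratedDeriv]
      exact hKt T₁ T₂ hT1 hT t
    refine abs_setIntegral_halfSp_le ((hballm _).prod measurableSet_Ioo)
      (fun z hz => hT1.trans hz.2.1) ((hu ρ hρ0).mono_set (hsub'.trans hsub)).abs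
      (Eventually.of_forall fun z _ => ?_) fun z hz hzS => ?_
    · rw [abs_mul, abs_mul, abs_mul, abs_pow, abs_neg, abs_one, one_pow, one_mul,
        abs_of_nonneg (hψ0 _), mul_comm]
      gcongr
      calc ψ z.1 * |iteratedDeriv k η z.2| ≤ 1 * |iteratedDeriv k η z.2| := by
            gcongr
            exact hψ1 _
        _ ≤ _ := by rw [one_mul]; exact habs _
    · have hpos : 0 < z.2 := hz
      rw [mem_prod, hmem, not_and_or, not_lt] at hzS
      rcases hzS with h | h
      · simp [hψz _ h]
      · have h0 : iteratedDeriv k η z.2 = 0 := by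
          rw [iteratedDeriv_eq_iteratedFDeriv,
            iteratedFDeriv_radialCutoff_eq_zero hT1 hT (by omega)]
          · rfl
          · rw [Real.norm_of_nonneg hpos.le]
            by_contra! h'
            exact h h'
        simp [h0]
  -- the spatial derivatives live in the outer shell
  have hspace : |∫ z in halfSp n,
        ∑ α ∈ mIdx n m, (-1 : ℝ) ^ m * a α z (u z) * mDeriv n α φ z|
      ≤ N * A * Kx / (r₂ - r₁) ^ m *
        ∫ z in (ball0 n r₂ \ ball0 n r₁) ×ˢ Ioo 0 T₂, |u z| ^ p := by
    have hsub' : (ball0 n r₂ \ ball0 n r₁) ×ˢ Ioo 0 T₂ ⊆ ball0 n r₂ ×ˢ Ioo 0 T₂ :=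
      prod_mono sdiff_subset le_rfl
    have hder : ∀ α ∈ mIdx n m, ∃ h : Spc n → ℝ, IsIteratedDirDeriv ψ m h ∧
        mDeriv n α φ = fun z => h z.1 * η z.2 := fun α hα => by
      obtain ⟨h, hh, he⟩ := exists_mDeriv_prod hψs η α
      rw [(Finset.mem_filter.1 hα).2] at hh
      exact ⟨h, hh, he⟩
    have haA : ∀ᵐ z ∂(volume.restrict (halfSp n)), ∀ α ∈ mIdx n m, ∀ ζ : ℝ,
        |a α z ζ| ≤ A * |ζ| ^ p :=
      (Filter.eventually_all_finset _).2 fun α hα => (ha α hα).2.2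
    refine abs_setIntegral_halfSp_le (((hballm _).diff (hballm _)).prod measurableSet_Ioo)
      (fun z hz => hz.2.1) ((hup ρ hρ0).mono_set (hsub'.trans hsub))
      ?_ fun z hz hzS => ?_
    · filter_upwards [haA] with z hz _
      have hterm : ∀ α ∈ mIdx n m, |(-1 : ℝ) ^ m * a α z (u z) * mDeriv n α φ z|
          ≤ A * |u z| ^ p * (Kx / (r₂ - r₁) ^ m) := fun α hα => by
        obtain ⟨h, hh, he⟩ := hder α hα
        rw [he, abs_mul, abs_mul, abs_mul, abs_pow, abs_neg, abs_one, one_pow, one_mul,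
          abs_of_nonneg (hη0 _)]
        have h1 : |h z.1| * η z.2 ≤ Kx / (r₂ - r₁) ^ m :=
          (mul_le_of_le_one_right (abs_nonneg _) (hη1 _)).trans
            ((hh.abs_le _).trans (hKx r₁ r₂ hr1 hr _))
        exact mul_le_mul (hz α hα _) h1 (mul_nonneg (abs_nonneg _) (hη0 _)) (by positivity)
      calc _ ≤ ∑ α ∈ mIdx n m, |(-1 : ℝ) ^ m * a α z (u z) * mDeriv n α φ z| :=
            Finset.abs_sum_le_sum_abs _ _
        _ ≤ ∑ _α ∈ mIdx n m, A * |u z| ^ p * (Kx / (r₂ - r₁) ^ m) := Finset.sum_le_sum hterm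
        _ = _ := by
          rw [Finset.sum_const, nsmul_eq_mul]
          ring
    · have hpos : 0 < z.2 := hz
      refine Finset.sum_eq_zero fun α hα => ?_
      obtain ⟨h, hh, he⟩ := hder α hα
      rw [he]
      rw [mem_prod, Set.mem_sdiff, hmem, hmem, not_and_or] at hzS
      rcases hzS with h' | h'
      · have h0 : h z.1 = 0 := by
          have h1 := hh.abs_le z.1
          rw [iteratedFDeriv_radialCutoff_eq_zero hr1 hr (by omega), norm_zero] at h1
          · exact abs_nonpos_iff.1 h1
          · by_contra! h''
            exact h' ⟨h''.2, h''.1.not_gt⟩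
        simp [h0]
      · have : T₂ ≤ ‖z.2‖ := by
          rw [Real.norm_of_nonneg hpos.le]
          by_contra! h''
          exact h' ⟨hpos, h''⟩
        simp [hηz _ this]
  set I₁ : ℝ := ∫ z in ball0 n r₂ ×ˢ Ioo T₁ T₂, |u z| with hI₁
  set I₂ : ℝ := ∫ z in (ball0 n r₂ \ ball0 n r₁) ×ˢ Ioo 0 T₂, |u z| ^ p with hI₂
  have hX0 : 0 ≤ I₁ / (T₂ - T₁) ^ k :=
    div_nonneg (integral_nonneg fun z => abs_nonneg _) (pow_nonneg (by linarith) _)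
  have hY0 : 0 ≤ I₂ / (r₂ - r₁) ^ m :=
    div_nonneg (integral_nonneg fun z => by positivity) (pow_nonneg (by linarith) _)
  have e1 : Kt / (T₂ - T₁) ^ k * I₁ = Kt * (I₁ / (T₂ - T₁) ^ k) := by ring
  have e2 : N * A * Kx / (r₂ - r₁) ^ m * I₂ = N * A * Kx * (I₂ / (r₂ - r₁) ^ m) := by ring
  rw [e1] at htime
  rw [e2] at hspace
  rw [inv_mul_le_iff₀ hK0]
  have h1 := (abs_le.1 htime).2
  have h2 := (abs_le.1 hspace).1
  have h3 : Kt * (I₁ / (T₂ - T₁) ^ k) ≤ K * (I₁ / (T₂ - T₁) ^ k) :=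
    mul_le_mul_of_nonneg_right (by linarith) hX0
  have h4 : N * A * Kx * (I₂ / (r₂ - r₁) ^ m) ≤ K * (I₂ / (r₂ - r₁) ^ m) :=
    mul_le_mul_of_nonneg_right (by linarith) hY0
  rw [mul_add]
  linarith
end
end
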